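/- Let F be a field of characteristic zero and k ≥ 1. Assume that for every 1 ≤ h ≤ k the maximal permanental ideal I_{h,h+1} of the generic h×(h+1) matrix has height h+1. Then for every n ≥ k+1, the maximal permanental ideal I_{k,n} of the generic k×n matrix has height n. -/

import Mathlib

open MvPolynomial

noncomputable section

/-- The permanent of a square matrix. -/
def perm {R : Type*} [CommRing R] {m : ℕ} (A : Matrix (Fin m) (Fin m) R) : R :=
  ∑ σ : Equiv.Perm (Fin m), ∏ i, A i (σ i)

/-- The height of an ideal: the infimum of the heights (in the prime spectrum)
of the primes containing it. -/
def idealHeight {R : Type*} [CommRing R] (I : Ideal R) : ℕ∞ :=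
  ⨅ (p : PrimeSpectrum R) (_ : I ≤ p.asIdeal), Order.height p

/-- The maximal permanental ideal `I_{k,n}`: the ideal generated by the permanents of all
`k × k` submatrices of the generic `k × n` matrix, obtained by selecting `k` of the `n`
columns via a strictly monotone map. -/
def permanentalIdeal (F : Type*) [Field F] (k n : ℕ) :
    Ideal (MvPolynomial (Fin k × Fin n) F) :=
  Ideal.span { p | ∃ c : Fin k → Fin n, StrictMono c ∧
    p = perm (Matrix.of fun i j => X (i, c j)) }

namespace PrimeSpectrum

variable {A : Type*} [CommRing A] (σ : Type*)

/-- The extension of a prime of `A` to the polynomial ring `A[σ]`. -/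
def mvPolynomialExtend (p : PrimeSpectrum A) : PrimeSpectrum (MvPolynomial σ A) :=
  ⟨RingHom.ker (MvPolynomial.map (σ := σ) (Ideal.Quotient.mk p.asIdeal)),
    RingHom.ker_isPrime _⟩

variable {σ}

theorem mem_mvPolynomialExtend {p : PrimeSpectrum A} {f : MvPolynomial σ A} :
    f ∈ (mvPolynomialExtend σ p).asIdeal ↔ ∀ m, coeff m f ∈ p.asIdeal := by
  simp [mvPolynomialExtend, RingHom.mem_ker, MvPolynomial.ext_iff, coeff_map,
    Ideal.Quotient.eq_zero_iff_mem]

theorem mvPolynomialExtend_strictMono :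
    StrictMono (mvPolynomialExtend σ : PrimeSpectrum A → PrimeSpectrum (MvPolynomial σ A)) := by
  refine Monotone.strictMono_of_injective (fun p q h f hf => ?_) fun p q h => ?_
  · rw [mem_mvPolynomialExtend] at hf ⊢
    exact fun m => h (hf m)
  · have key : ∀ (p : PrimeSpectrum A) a,
        C a ∈ (mvPolynomialExtend σ p).asIdeal ↔ a ∈ p.asIdeal := by
      intro p a
      rw [mem_mvPolynomialExtend]
      classical
      refine ⟨fun h => by simpa using h 0, fun h m => ?_⟩
      rw [coeff_C]
      split_ifs
      exacts [h, zero_mem _]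
    ext a
    rw [← key p, h, key q]

theorem mvPolynomialExtend_comap_C_le (q : PrimeSpectrum (MvPolynomial σ A)) :
    mvPolynomialExtend σ (comap C q) ≤ q := by
  intro f hf
  rw [mem_mvPolynomialExtend] at hf
  rw [f.as_sum]
  refine Ideal.sum_mem _ fun m _ => ?_
  rw [← mul_one (coeff m f), ← C_mul_monomial]
  exact Ideal.mul_mem_right _ _ (hf m)

theorem height_comap_C_le (q : PrimeSpectrum (MvPolynomial σ A)) :
    Order.height (comap C q) ≤ Order.height q :=
  (Order.height_le_height_apply_of_strictMono _ mvPolynomialExtend_strictMono _).trans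
    (Order.height_mono (mvPolynomialExtend_comap_C_le q))

theorem height_comap_C_add_one_le {q : PrimeSpectrum (MvPolynomial σ A)} {f : MvPolynomial σ A}
    (hf : f ∈ q.asIdeal) {m : σ →₀ ℕ} (hm : C (coeff m f) ∉ q.asIdeal) :
    Order.height (comap C q) + 1 ≤ Order.height q := by
  have hlt : mvPolynomialExtend σ (comap C q) < q :=
    lt_of_le_of_ne (mvPolynomialExtend_comap_C_le q) fun h => by
      rw [← h, mem_mvPolynomialExtend] at hf
      exact hm (hf m)
  refine le_trans ?_ (Order.height_add_one_le hlt)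
  gcongr
  exact Order.height_le_height_apply_of_strictMono _ mvPolynomialExtend_strictMono _

end PrimeSpectrum

namespace MvPolynomial

variable {F σ ρ τ : Type*} [CommRing F] {u : σ → τ} {v : ρ → τ}

/-- The polynomial ring in variables split into two families is an iterated polynomial ring. -/
def splitEquiv (F : Type*) [CommRing F] (h : Function.Bijective (Sum.elim u v)) :
    MvPolynomial τ F ≃ₐ[F] MvPolynomial σ (MvPolynomial ρ F) :=
  (renameEquiv F (Equiv.ofBijective _ h).symm).trans (sumAlgEquiv F σ ρ)

theorem splitEquiv_X (h : Function.Bijective (Sum.elim u v)) (s : σ) :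
    splitEquiv F h (X (u s)) = X s := by
  have : (Equiv.ofBijective _ h).symm (u s) = .inl s := by
    rw [Equiv.symm_apply_eq]; rfl
  simp [splitEquiv, this]

theorem splitEquiv_rename (h : Function.Bijective (Sum.elim u v)) (f : MvPolynomial ρ F) :
    splitEquiv F h (rename v f) = C f := by
  have hv : ∀ r, (Equiv.ofBijective _ h).symm (v r) = .inr r := fun r => by
    rw [Equiv.symm_apply_eq]; rfl
  induction f using MvPolynomial.induction_on with
  | C a => simp [splitEquiv]
  | add p q hp hq => simp [hp, hq]
  | mul_X p i hp => rw [map_mul, map_mul, hp]; simp [splitEquiv, hv]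

theorem comap_C_comapEquiv_splitEquiv (h : Function.Bijective (Sum.elim u v))
    (q : PrimeSpectrum (MvPolynomial τ F)) :
    PrimeSpectrum.comap C (PrimeSpectrum.comapEquiv (splitEquiv F h).toRingEquiv q) =
      PrimeSpectrum.comap (rename (R := F) v).toRingHom q := by
  ext f
  change (splitEquiv F h).symm (C f) ∈ q.asIdeal ↔ rename v f ∈ q.asIdeal
  rw [← splitEquiv_rename h, AlgEquiv.symm_apply_apply]

theorem height_comap_rename_le (h : Function.Bijective (Sum.elim u v))
    (q : PrimeSpectrum (MvPolynomial τ F)) :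
    Order.height (PrimeSpectrum.comap (rename (R := F) v).toRingHom q) ≤ Order.height q := by
  rw [← comap_C_comapEquiv_splitEquiv h,
    ← Order.height_orderIso (PrimeSpectrum.comapEquiv (splitEquiv F h).toRingEquiv) q]
  exact PrimeSpectrum.height_comap_C_le _

/-- A prime containing a linear form in the new variables, with a coefficient outside of
the contracted prime, has height strictly larger than that of its contraction. -/
theorem height_comap_rename_add_one_le [Fintype σ] (h : Function.Bijective (Sum.elim u v))
    {q : PrimeSpectrum (MvPolynomial τ F)} {a : σ → MvPolynomial ρ F}
    (ha : ∑ s, X (u s) * rename v (a s) ∈ q.asIdeal) {s : σ} (hs : rename v (a s) ∉ q.asIdeal) :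
    Order.height (PrimeSpectrum.comap (rename (R := F) v).toRingHom q) + 1 ≤ Order.height q := by
  classical
  rw [← comap_C_comapEquiv_splitEquiv h,
    ← Order.height_orderIso (PrimeSpectrum.comapEquiv (splitEquiv F h).toRingEquiv) q]
  refine PrimeSpectrum.height_comap_C_add_one_le (f := ∑ s, X s * C (a s))
    (m := Finsupp.single s 1) ?_ ?_
  · change (splitEquiv F h).symm _ ∈ q.asIdeal
    convert ha
    rw [AlgEquiv.symm_apply_eq]
    simp [splitEquiv_X, splitEquiv_rename]
  · have hc : coeff (Finsupp.single s 1) (∑ s, X s * C (a s)) = a s := by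
      simp [coeff_sum, mul_comm (X _), coeff_C_mul, coeff_X, Finsupp.single_left_inj]
    rw [hc]
    change (splitEquiv F h).symm (C (a s)) ∉ q.asIdeal
    rwa [← splitEquiv_rename h, AlgEquiv.symm_apply_apply]

end MvPolynomial

section Perm

variable {R : Type*} [CommRing R] {m : ℕ}

theorem map_perm {S G : Type*} [CommRing S] [FunLike G R S] [RingHomClass G R S] (φ : G)
    (A : Matrix (Fin m) (Fin m) R) : φ (perm A) = perm (A.map φ) := by
  simp [perm, map_sum, map_prod]

theorem perm_transpose (A : Matrix (Fin m) (Fin m) R) : perm A.transpose = perm A := by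
  rw [perm, perm, ← Equiv.sum_comp (Equiv.inv _)]
  refine Finset.sum_congr rfl fun σ _ => ?_
  rw [← Equiv.prod_comp σ]
  simp

theorem perm_submatrix_id_equiv (A : Matrix (Fin m) (Fin m) R) (τ : Equiv.Perm (Fin m)) :
    perm (A.submatrix id τ) = perm A := by
  rw [perm, perm, ← Equiv.sum_comp (Equiv.mulLeft τ) fun σ => ∏ i, A i (σ i)]
  simp

theorem perm_succ_row_zero (A : Matrix (Fin (m + 1)) (Fin (m + 1)) R) :
    perm A = ∑ j, A 0 j * perm (A.submatrix Fin.succ j.succAbove) := by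
  let Φ : Fin (m + 1) × Equiv.Perm (Fin m) → Equiv.Perm (Fin (m + 1)) := fun x =>
    x.1.cycleRange⁻¹ * Equiv.Perm.decomposeFin.symm (0, x.2)
  have h0 : ∀ x, Φ x 0 = x.1 := fun x => by
    simp [Φ, Equiv.Perm.inv_def]
  have h1 : ∀ x i, Φ x (Fin.succ i) = x.1.succAbove (x.2 i) := fun x i => by
    simp [Φ, Equiv.Perm.inv_def]
  have hΦ : Function.Bijective Φ := by
    rw [Fintype.bijective_iff_injective_and_card]
    refine ⟨?_, by simp [Fintype.card_perm, Nat.factorial_succ]⟩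
    rintro ⟨p, e⟩ ⟨p', e'⟩ h
    obtain rfl : p = p' := by simpa [h0] using DFunLike.congr_fun h 0
    refine Prod.ext rfl (Equiv.ext fun i => ?_)
    have := h1 (p, e) i
    rw [h, h1] at this
    exact (Fin.succAbove_right_injective this).symm
  rw [perm, ← hΦ.sum_comp, Fintype.sum_prod_type]
  simp [perm, Finset.mul_sum, Fin.prod_univ_succ, h0, h1]

theorem perm_succ_column_zero (A : Matrix (Fin (m + 1)) (Fin (m + 1)) R) :
    perm A = ∑ i, A i 0 * perm (A.submatrix i.succAbove Fin.succ) := by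
  rw [← perm_transpose, perm_succ_row_zero]
  refine Finset.sum_congr rfl fun i _ => ?_
  rw [← perm_transpose (A.submatrix _ _)]
  rfl

end Perm

section GenericMinor

variable (F : Type*) [Field F]

/-- The permanent of the generic matrix restricted to the given rows and columns. -/
def genericPerm {a b m : ℕ} (r : Fin m → Fin a) (c : Fin m → Fin b) :
    MvPolynomial (Fin a × Fin b) F :=
  perm (Matrix.of fun i j => X (r i, c j))

variable {F}

theorem rename_genericPerm {a b a' b' m : ℕ} (r : Fin m → Fin a) (c : Fin m → Fin b)
    (f : Fin a → Fin a') (g : Fin b → Fin b') :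
    rename (Prod.map f g) (genericPerm F r c) = genericPerm F (f ∘ r) (g ∘ c) := by
  rw [genericPerm, map_perm]
  congr 1
  ext i j : 2
  simp

theorem genericPerm_mem_of_injective {k n : ℕ} {q : Ideal (MvPolynomial (Fin k × Fin n) F)}
    (hq : permanentalIdeal F k n ≤ q) {c : Fin k → Fin n} (hc : Function.Injective c) :
    genericPerm F id c ∈ q := by
  have hmono : StrictMono (c ∘ Tuple.sort c) :=
    (Tuple.monotone_sort c).strictMono_of_injective (hc.comp (Equiv.injective _))
  rw [genericPerm, ← perm_submatrix_id_equiv _ (Tuple.sort c)]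
  exact hq (Ideal.subset_span ⟨_, hmono, rfl⟩)

theorem genericPerm_cons_column {k n : ℕ} (c : Fin k → Fin n) :
    genericPerm F id (Fin.cons 0 (Fin.succ ∘ c) : Fin (k + 1) → Fin (n + 1)) =
      ∑ i : Fin (k + 1), X (i, 0) * rename (Prod.map id Fin.succ)
        (genericPerm F i.succAbove c) := by
  rw [genericPerm, perm_succ_column_zero]
  refine Finset.sum_congr rfl fun i _ => ?_
  rw [rename_genericPerm]
  rfl

theorem genericPerm_succ_succAbove {k n : ℕ} (i : Fin (k + 1)) (c : Fin (k + 1) → Fin n) :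
    genericPerm F i.succ.succAbove c =
      ∑ j, X (0, c j) * rename (Prod.map Fin.succ id)
        (genericPerm F i.succAbove (c ∘ j.succAbove)) := by
  rw [genericPerm, perm_succ_row_zero]
  refine Finset.sum_congr rfl fun j _ => ?_
  rw [rename_genericPerm, genericPerm]
  congr 2
  ext x y : 2
  simp

theorem column_split_bijective (k n : ℕ) : Function.Bijective
    (Sum.elim (fun i : Fin k => (i, (0 : Fin (n + 1)))) (Prod.map id Fin.succ)) := by
  constructor
  · rintro (i | ⟨i, j⟩) (i' | ⟨i', j'⟩) h <;> simp_all [eq_comm]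
  · rintro ⟨i, j⟩
    cases j using Fin.cases with
    | zero => exact ⟨.inl i, rfl⟩
    | succ j => exact ⟨.inr (i, j), rfl⟩

theorem row_split_bijective (k n : ℕ) : Function.Bijective
    (Sum.elim (fun j : Fin n => ((0 : Fin (k + 1)), j)) (Prod.map Fin.succ id)) := by
  constructor
  · rintro (i | ⟨i, j⟩) (i' | ⟨i', j'⟩) h <;> simp_all [eq_comm]
  · rintro ⟨i, j⟩
    cases i using Fin.cases with
    | zero => exact ⟨.inl j, rfl⟩
    | succ i => exact ⟨.inr (i, j), rfl⟩

/-- The submaximal permanents of a generic matrix cut out a locus of codimension larger than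
the number of columns, provided the maximal permanental ideals with fewer rows have the expected
height. -/
theorem height_of_submaximal_permanents (n : ℕ) : ∀ k, k ≤ n →
    (∀ l < k, ∀ q : PrimeSpectrum (MvPolynomial (Fin (l + 1) × Fin n) F),
      (∀ c : Fin (l + 1) → Fin n, c.Injective → genericPerm F id c ∈ q.asIdeal) →
        (n : ℕ∞) ≤ Order.height q) →
    ∀ q : PrimeSpectrum (MvPolynomial (Fin (k + 1) × Fin n) F),
      (∀ (i : Fin (k + 1)) (c : Fin k → Fin n), c.Injective →
        genericPerm F i.succAbove c ∈ q.asIdeal) →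
        ((n + 1 : ℕ) : ℕ∞) ≤ Order.height q := by
  intro k
  induction k with
  | zero =>
    intro _ _ q hq
    refine absurd (hq 0 Fin.elim0 fun i => i.elim0) ?_
    simpa [genericPerm, perm] using q.isPrime.one_notMem
  | succ k ih =>
    intro hk hmax q hq
    have hmem : ∀ f, f ∈ (PrimeSpectrum.comap
        (rename (R := F) (Prod.map (Fin.succ : Fin (k + 1) → _) (id : Fin n → _))).toRingHom
        q).asIdeal ↔ rename (Prod.map Fin.succ id) f ∈ q.asIdeal := fun f => Iff.rfl
    by_cases hsub : ∀ (i : Fin (k + 1)) (c : Fin k → Fin n), c.Injective →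
        rename (Prod.map Fin.succ id) (genericPerm F i.succAbove c) ∈ q.asIdeal
    · exact (ih (by omega) (fun l hl => hmax l (by omega)) _ hsub).trans
        (height_comap_rename_le (row_split_bijective (k + 1) n) q)
    · push Not at hsub
      obtain ⟨i, c, hc, hic⟩ := hsub
      obtain ⟨x, hx⟩ : ∃ x, x ∉ Set.range c := by
        by_contra! h
        have := Fintype.card_le_of_surjective c h
        simp at this
        omega
      set d : Fin (k + 1) → Fin n := Fin.cons x c with hd
      have hdinj : d.Injective := Fin.cons_injective_iff.2 ⟨hx, hc⟩
      have hlow : (n : ℕ∞) ≤ Order.height (PrimeSpectrum.comap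
          (rename (R := F) (Prod.map (Fin.succ : Fin (k + 1) → _) (id : Fin n → _))).toRingHom
          q) := by
        refine hmax k k.lt_succ_self _ fun c hc => ?_
        rw [hmem, rename_genericPerm]
        simpa [Fin.succAbove_zero] using hq 0 c hc
      classical
      let a : Fin n → MvPolynomial (Fin (k + 1) × Fin n) F := fun y =>
        ∑ j with d j = y, genericPerm F i.succAbove (d ∘ j.succAbove)
      have ha : a x = genericPerm F i.succAbove c := by
        have : ({j | d j = x} : Finset (Fin (k + 1))) = {0} := by
          ext j
          simpa [hd] using hdinj.eq_iff (a := j) (b := 0)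
        simp only [a, this, Finset.sum_singleton]
        congr 1
      refine le_trans ?_ (height_comap_rename_add_one_le (row_split_bijective (k + 1) n)
        (q := q) (a := a) (s := x) ?_ (by rwa [ha]))
      · push_cast
        gcongr
      · convert hq i.succ d hdinj using 1
        rw [genericPerm_succ_succAbove, ← Finset.sum_fiberwise (s := Finset.univ) (g := d)]
        refine Finset.sum_congr rfl fun y _ => ?_
        rw [map_sum, Finset.mul_sum]
        refine Finset.sum_congr rfl fun j hj => ?_
        rw [(Finset.mem_filter.1 hj).2]

theorem height_of_maximal_permanents_succ {k n : ℕ}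
    (hmax : ∀ q : PrimeSpectrum (MvPolynomial (Fin (k + 1) × Fin n) F),
      (∀ c : Fin (k + 1) → Fin n, c.Injective → genericPerm F id c ∈ q.asIdeal) →
        (n : ℕ∞) ≤ Order.height q)
    (hsubmax : ∀ q : PrimeSpectrum (MvPolynomial (Fin (k + 1) × Fin n) F),
      (∀ (i : Fin (k + 1)) (c : Fin k → Fin n), c.Injective →
        genericPerm F i.succAbove c ∈ q.asIdeal) →
        ((n + 1 : ℕ) : ℕ∞) ≤ Order.height q)
    (q : PrimeSpectrum (MvPolynomial (Fin (k + 1) × Fin (n + 1)) F))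
    (hq : ∀ c : Fin (k + 1) → Fin (n + 1), c.Injective → genericPerm F id c ∈ q.asIdeal) :
    ((n + 1 : ℕ) : ℕ∞) ≤ Order.height q := by
  by_cases hsub : ∀ (i : Fin (k + 1)) (c : Fin k → Fin n), c.Injective →
      rename (Prod.map id Fin.succ) (genericPerm F i.succAbove c) ∈ q.asIdeal
  · exact (hsubmax _ hsub).trans (height_comap_rename_le (column_split_bijective (k + 1) n) q)
  · push Not at hsub
    obtain ⟨i, c, hc, hic⟩ := hsub
    refine le_trans ?_ (height_comap_rename_add_one_le (column_split_bijective (k + 1) n)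
      (q := q) (a := fun i => genericPerm F i.succAbove c) (s := i) ?_ hic)
    · push_cast
      gcongr
      refine hmax _ fun c hc => ?_
      change rename (Prod.map id Fin.succ) _ ∈ q.asIdeal
      rw [rename_genericPerm]
      exact hq _ ((Fin.succ_injective _).comp hc)
    · rw [← genericPerm_cons_column]
      exact hq _ (Fin.cons_injective_iff.2
        ⟨by simp [Fin.succ_ne_zero], (Fin.succ_injective _).comp hc⟩)

theorem height_of_maximal_permanents {k : ℕ}
    (hyp : ∀ l < k, ((l + 2 : ℕ) : ℕ∞) ≤ idealHeight (permanentalIdeal F (l + 1) (l + 2))) :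
    ∀ l < k, ∀ n, l + 2 ≤ n → ∀ q : PrimeSpectrum (MvPolynomial (Fin (l + 1) × Fin n) F),
      (∀ c : Fin (l + 1) → Fin n, c.Injective → genericPerm F id c ∈ q.asIdeal) →
        (n : ℕ∞) ≤ Order.height q := by
  intro l
  induction l using Nat.strong_induction_on with
  | _ l ihl =>
    intro hl n hn
    induction n, hn using Nat.le_induction with
    | base =>
      intro q hq
      refine (hyp l hl).trans (iInf₂_le q (Ideal.span_le.2 ?_))
      rintro _ ⟨c, hc, rfl⟩
      exact hq c hc.injective
    | succ n hn ihn =>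
      exact height_of_maximal_permanents_succ ihn
        (height_of_submaximal_permanents n l (by omega)
          fun l' hl' => ihl l' hl' (by omega) n (by omega))

theorem permanentalIdeal_succ_le_span_row (k n : ℕ) :
    permanentalIdeal F (k + 1) n ≤ Ideal.span (Set.range fun j => X (0, j)) := by
  rw [permanentalIdeal, Ideal.span_le]
  rintro _ ⟨c, -, rfl⟩
  rw [perm_succ_row_zero]
  exact Ideal.sum_mem _ fun j _ => Ideal.mul_mem_right _ _ (Ideal.subset_span ⟨c j, rfl⟩)

theorem idealHeight_permanentalIdeal_succ_le (k n : ℕ) :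
    idealHeight (permanentalIdeal F (k + 1) n) ≤ n := by
  set s : Set (MvPolynomial (Fin (k + 1) × Fin n) F) := Set.range fun j => X (0, j)
  have hle : Ideal.span s ≤ RingHom.ker (constantCoeff (R := F)) := by
    rw [Ideal.span_le]
    rintro _ ⟨j, rfl⟩
    exact constantCoeff_X F _
  obtain ⟨P, hP⟩ := Ideal.nonempty_minimalPrimes
    (ne_top_of_le_ne_top (RingHom.ker_ne_top _) hle)
  have hcard : P.height ≤ n := by
    refine (Ideal.height_le_card_of_mem_minimalPrimes_span (Set.finite_range _) hP).trans ?_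
    rw [Nat.cast_le, ← Set.image_univ]
    exact (Set.ncard_image_le Set.finite_univ).trans (by simp)
  have hPprime := hP.1.1
  refine le_trans (iInf₂_le (⟨P, hPprime⟩ : PrimeSpectrum _)
    ((permanentalIdeal_succ_le_span_row k n).trans hP.1.2)) ?_
  rwa [← PrimeSpectrum.height_eq_orderHeight]

end GenericMinor

/-- For a field `F` of characteristic zero and `k ≥ 1`: if for every `1 ≤ h ≤ k` the
maximal permanental ideal `I_{h,h+1}` has height `h + 1`, then for every `n ≥ k + 1` the
maximal permanental ideal `I_{k,n}` has height `n`. -/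
theorem statement14 (F : Type*) [Field F] [CharZero F] (k : ℕ) (hk : 1 ≤ k)
    (hyp : ∀ h : ℕ, 1 ≤ h → h ≤ k →
      idealHeight (permanentalIdeal F h (h + 1)) = ((h + 1 : ℕ) : ℕ∞)) :
    ∀ n : ℕ, k + 1 ≤ n → idealHeight (permanentalIdeal F k n) = (n : ℕ∞) := by
  obtain ⟨k, rfl⟩ : ∃ l, k = l + 1 := ⟨k - 1, by omega⟩
  intro n hn
  refine le_antisymm (idealHeight_permanentalIdeal_succ_le k n) (le_iInf₂ fun q hq => ?_)
  exact height_of_maximal_permanents (k := k + 1)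
    (fun l hl => (hyp (l + 1) (by omega) (by omega)).ge) k k.lt_succ_self n hn q
    fun c hc => genericPerm_mem_of_injective hq hc

end
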